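/- arXiv:2305.11774 — 7 statements merged into one kernel-verified Lean document; each statement's English description precedes it below -/
import Mathlib

section
/- Let (Θ, μ) be a probability space and s : Θ × ℝ^M → ℝ a family of scalarisation functions such that for every y ∈ ℝ^M the map θ ↦ s(θ, y) is integrable with respect to μ. Define the R2 utility on nonempty finite subsets Y of ℝ^M by U(Y) = ∫_Θ max_{y ∈ Y} s(θ, y) dμ(θ). Then U is monotone and submodular: for all nonempty finite sets A ⊆ B ⊆ ℝ^M and all c ∈ ℝ^M, U(A) ≤ U(B) and U(A ∪ {c}) − U(A) ≥ U(B ∪ {c}) − U(B). -/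
open MeasureTheory

/-- A finite maximum of integrable real functions is integrable. -/
theorem integrable_finset_sup' {Θ ι : Type*} [MeasurableSpace Θ] {μ : Measure Θ}
    {s : Θ → ι → ℝ} {A : Finset ι} (hA : A.Nonempty)
    (hint : ∀ y ∈ A, Integrable (fun θ => s θ y) μ) :
    Integrable (fun θ => A.sup' hA (s θ)) μ := by
  induction hA using Finset.Nonempty.cons_induction with
  | singleton a => simpa using hint a
  | cons a A ha hA ih =>
    simp only [Finset.sup'_cons hA]
    exact (hint a (Finset.mem_cons_self a A)).sup
      (ih fun y hy => hint y (Finset.mem_cons_of_mem hy))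

/-- The increment of `x ↦ max c x` over `x` is antitone in `x`. -/
theorem sup_sub_self_antitone (c : ℝ) : Antitone fun x : ℝ => c ⊔ x - x := by
  intro a b hab
  simp only [← max_sub_sub_right, sub_self]
  exact max_le_max (sub_le_sub_left hab c) le_rfl

/-- The R2 utility `U(Y) = ∫_Θ max_{y ∈ Y} s(θ, y) dμ(θ)` is monotone and
submodular on nonempty finite subsets of `ℝ^M`. -/
theorem r2_utility_monotone_submodular
    {M : ℕ} {Θ : Type*} [MeasurableSpace Θ] (μ : Measure Θ) [IsProbabilityMeasure μ]
    (s : Θ → (Fin M → ℝ) → ℝ)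
    (hint : ∀ y : Fin M → ℝ, Integrable (fun θ => s θ y) μ)
    (A B : Finset (Fin M → ℝ)) (hA : A.Nonempty) (hAB : A ⊆ B) (c : Fin M → ℝ) :
    (∫ θ, A.sup' hA (s θ) ∂μ) ≤ (∫ θ, B.sup' (hA.mono hAB) (s θ) ∂μ) ∧
    (∫ θ, (insert c B).sup' (Finset.insert_nonempty c B) (s θ) ∂μ) -
        (∫ θ, B.sup' (hA.mono hAB) (s θ) ∂μ) ≤
      (∫ θ, (insert c A).sup' (Finset.insert_nonempty c A) (s θ) ∂μ) -
        (∫ θ, A.sup' hA (s θ) ∂μ) := by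
  have integrable_sup (Y : Finset (Fin M → ℝ)) (hY : Y.Nonempty) :
      Integrable (fun θ => Y.sup' hY (s θ)) μ :=
    integrable_finset_sup' hY fun y _ => hint y
  have sup_mono (θ : Θ) : A.sup' hA (s θ) ≤ B.sup' (hA.mono hAB) (s θ) :=
    Finset.sup'_mono (s θ) hAB hA
  refine ⟨integral_mono (integrable_sup _ _) (integrable_sup _ _) sup_mono, ?_⟩
  rw [← integral_sub (integrable_sup _ _) (integrable_sup _ _),
    ← integral_sub (integrable_sup _ _) (integrable_sup _ _)]
  refine integral_mono ((integrable_sup _ _).sub (integrable_sup _ _))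
    ((integrable_sup _ _).sub (integrable_sup _ _)) fun θ => ?_
  simp only [Finset.sup'_insert (H := hA), Finset.sup'_insert (H := hA.mono hAB)]
  exact sup_sub_self_antitone (s θ c) (sup_mono θ)
end

section
/- Let M ≥ 1, let Y be a nonempty finite subset of ℝ^M and η ∈ ℝ^M. Then the M-dimensional Lebesgue measure of the dominated region ⋃_{y ∈ Y} {z ∈ ℝ^M : η ≤ z ≤ y componentwise} equals the expectation, with respect to the uniform probability distribution of λ on the positive part of the unit sphere S_+^{M−1} = {λ ∈ ℝ^M : λ_m > 0 for all m and ‖λ‖_2 = 1} (i.e. the spherical surface measure restricted to the positive orthant and normalised to total mass one), of max_{y ∈ Y} s^{HV}_{(η,λ)}(y), where the hypervolume scalarisation function is s^{HV}_{(η,λ)}(y) = (π^{M/2} / (2^M Γ(M/2 + 1))) · min_{m=1,…,M} ( max(0, y_m − η_m) / λ_m )^M and Γ is the Gamma function. -/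
open MeasureTheory
open scoped MeasureTheory

section Uniqueness

variable {X : Type*} [MetricSpace X] [SecondCountableTopology X] [MeasurableSpace X] [BorelSpace X]

theorem mul_measure_le_of_uniformlyDistributed {μ ν : Measure X} [IsFiniteMeasure μ]
    [IsFiniteMeasure ν] {S : Set X} (hμS : ∀ᵐ x ∂μ, x ∈ S) (hνS : ∀ᵐ x ∂ν, x ∈ S)
    (hμ : ∀ x ∈ S, ∀ y ∈ S, ∀ r, μ (Metric.ball x r) = μ (Metric.ball y r))
    (hν : ∀ x ∈ S, ∀ y ∈ S, ∀ r, ν (Metric.ball x r) = ν (Metric.ball y r))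
    {K : Set X} (hK : IsClosed K) : ν Set.univ * μ K ≤ μ Set.univ * ν K := by
  rcases eq_or_ne μ 0 with rfl | hμ0
  · simp
  obtain ⟨x₀, hx₀⟩ : S.Nonempty := by
    have : NeZero μ := ⟨hμ0⟩
    exact hμS.exists
  have hpos : ∀ r > 0, μ (Metric.ball x₀ r) ≠ 0 := by
    intro r hr h0
    have hS : μ S = 0 := by
      refine measure_null_of_locally_null S fun x hx ↦ ⟨Metric.ball x r, ?_, ?_⟩
      · exact mem_nhdsWithin_of_mem_nhds (Metric.ball_mem_nhds x hr)
      · rw [hμ x hx x₀ hx₀, h0]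
    have : NeZero μ := ⟨hμ0⟩
    obtain ⟨x, hx, hx'⟩ := (hμS.and (measure_eq_zero_iff_ae_notMem.1 hS)).exists
    exact hx' hx
  have key : ∀ (A : Set X), MeasurableSet A → ∀ r : ℝ,
      (μ.prod ν) {p | p.1 ∈ A ∧ dist p.1 p.2 < r} = ν (Metric.ball x₀ r) * μ A ∧
      (μ.prod ν) {p | p.2 ∈ A ∧ dist p.1 p.2 < r} = μ (Metric.ball x₀ r) * ν A := by
    intro A hA r
    have hd : MeasurableSet {p : X × X | dist p.1 p.2 < r} :=
      measurableSet_lt measurable_dist measurable_const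
    have hs₁ : MeasurableSet {p : X × X | p.1 ∈ A ∧ dist p.1 p.2 < r} :=
      (measurable_fst hA).inter hd
    have hs₂ : MeasurableSet {p : X × X | p.2 ∈ A ∧ dist p.1 p.2 < r} :=
      (measurable_snd hA).inter hd
    constructor
    · rw [Measure.prod_apply hs₁,
        ← lintegral_indicator_const hA]
      refine lintegral_congr_ae ?_
      filter_upwards [hμS] with x hx
      by_cases hxA : x ∈ A
      · rw [Set.indicator_of_mem hxA, ← hν x hx x₀ hx₀ r]
        congr 1
        ext y
        simp [hxA, dist_comm]
      · simp [hxA]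
    · rw [Measure.prod_apply_symm hs₂,
        ← lintegral_indicator_const hA]
      refine lintegral_congr_ae ?_
      filter_upwards [hνS] with x hx
      by_cases hxA : x ∈ A
      · rw [Set.indicator_of_mem hxA, ← hμ x hx x₀ hx₀ r]
        congr 1
        ext y
        simp [hxA]
      · simp [hxA]
  have step : ∀ r > 0, ν Set.univ * μ K ≤ μ Set.univ * ν (Metric.thickening r K) := by
    intro r hr
    have h1 : ν (Metric.ball x₀ r) * μ Set.univ = μ (Metric.ball x₀ r) * ν Set.univ := by
      rw [← (key Set.univ .univ r).1, ← (key Set.univ .univ r).2]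
      simp
    have h2 : ν (Metric.ball x₀ r) * μ K ≤ μ (Metric.ball x₀ r) * ν (Metric.thickening r K) := by
      rw [← (key K hK.measurableSet r).1,
        ← (key _ Metric.isOpen_thickening.measurableSet r).2]
      refine measure_mono fun p hp ↦ ⟨Metric.mem_thickening_iff.2 ⟨p.1, hp.1, ?_⟩, hp.2⟩
      rw [dist_comm]
      exact hp.2
    rw [← ENNReal.mul_le_mul_iff_right (hpos r hr) (measure_ne_top _ _)]
    calc μ (Metric.ball x₀ r) * (ν Set.univ * μ K)
        = μ Set.univ * (ν (Metric.ball x₀ r) * μ K) := by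
          rw [← mul_assoc, ← h1]; ring
      _ ≤ μ Set.univ * (μ (Metric.ball x₀ r) * ν (Metric.thickening r K)) := by gcongr
      _ = _ := by ring
  have hlim := tendsto_measure_thickening_of_isClosed (μ := ν) ⟨1, one_pos, measure_ne_top _ _⟩ hK
  refine ge_of_tendsto (ENNReal.Tendsto.const_mul hlim (Or.inr (measure_ne_top _ _))) ?_
  filter_upwards [self_mem_nhdsWithin] with r hr using step r hr

/-- Two finite measures concentrated on a common set, each giving equal mass to all balls of equal
radius centred in that set, are proportional. -/
theorem smul_eq_smul_of_uniformlyDistributed {μ ν : Measure X} [IsFiniteMeasure μ]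
    [IsFiniteMeasure ν] {S : Set X} (hμS : ∀ᵐ x ∂μ, x ∈ S) (hνS : ∀ᵐ x ∂ν, x ∈ S)
    (hμ : ∀ x ∈ S, ∀ y ∈ S, ∀ r, μ (Metric.ball x r) = μ (Metric.ball y r))
    (hν : ∀ x ∈ S, ∀ y ∈ S, ∀ r, ν (Metric.ball x r) = ν (Metric.ball y r)) :
    ν Set.univ • μ = μ Set.univ • ν := by
  have : IsFiniteMeasure (ν Set.univ • μ) := μ.smul_finite (measure_ne_top _ _)
  refine ext_of_generate_finite _ ((BorelSpace.measurable_eq (α := X)).trans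
    borel_eq_generateFrom_isClosed) isPiSystem_isClosed (fun K hK ↦ ?_) (by simp [mul_comm])
  simp only [Measure.smul_apply, smul_eq_mul]
  exact le_antisymm (mul_measure_le_of_uniformlyDistributed hμS hνS hμ hν hK)
    (mul_measure_le_of_uniformlyDistributed hνS hμS hν hμ hK)

end Uniqueness

/-- A measure invariant under linear isometries gives equal mass to balls of equal radius whose
centres have equal norm. -/
theorem measure_ball_eq_of_forall_measurePreserving {E : Type*} [NormedAddCommGroup E]
    [InnerProductSpace ℝ E] [FiniteDimensional ℝ E] [MeasurableSpace E] [BorelSpace E]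
    {μ : Measure E} (h : ∀ e : E ≃ₗᵢ[ℝ] E, MeasurePreserving e μ μ) {x y : E} (hxy : ‖x‖ = ‖y‖)
    (r : ℝ) : μ (Metric.ball x r) = μ (Metric.ball y r) := by
  set e := (Submodule.span ℝ {x - y})ᗮ.reflection
  have he : e x = y := Submodule.reflection_sub hxy
  rw [← (h e).measure_preimage Metric.isOpen_ball.nullMeasurableSet (s := Metric.ball y r), ← he,
    e.preimage_ball]
  simp

theorem hausdorffMeasure_sphere_lt_top (n : ℕ) :
    μH[(n : ℝ)] (Metric.sphere (0 : EuclideanSpace ℝ (Fin (n + 1))) 1) < ⊤ := by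
  let g (i : Fin (n + 1)) (s : ℝ) (v : Fin n → ℝ) : EuclideanSpace ℝ (Fin (n + 1)) :=
    WithLp.toLp 2 (i.insertNth s v)
  have hgi (i s v) : g i s v i = s := by simp [g]
  have hgs (i s v j) : g i s v (i.succAbove j) = v j := by simp [g]
  let f (i : Fin (n + 1)) (s : ℝ) (v : Fin n → ℝ) : EuclideanSpace ℝ (Fin (n + 1)) :=
    ‖g i s v‖⁻¹ • g i s v
  have hcover : Metric.sphere (0 : EuclideanSpace ℝ (Fin (n + 1))) 1 ⊆
      ⋃ i, ⋃ s ∈ ({1, -1} : Set ℝ), f i s '' Metric.closedBall 0 1 := by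
    intro x hx
    have hx1 : ‖x‖ = 1 := by simpa using hx
    obtain ⟨i, hi⟩ := Finite.exists_max fun i ↦ |x i|
    have hxi : 0 < |x i| := by
      by_contra! h
      have : x = 0 := by
        ext j
        simpa using (hi j).trans h
      simp [this] at hx1
    have hg : g i (x i / |x i|) (fun j ↦ x (i.succAbove j) / |x i|) = |x i|⁻¹ • x := by
      ext k
      rcases Fin.eq_self_or_eq_succAbove i k with rfl | ⟨j, rfl⟩
      · rw [hgi]; simp [div_eq_inv_mul]
      · rw [hgs]; simp [div_eq_inv_mul]
    simp only [Set.mem_iUnion]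
    refine ⟨i, x i / |x i|, ?_, fun j ↦ x (i.succAbove j) / |x i|, ?_, ?_⟩
    · rcases abs_choice (x i) with h | h
      · left; rw [h] at hxi ⊢; exact div_self hxi.ne'
      · right
        rw [Set.mem_singleton_iff, h, div_neg, div_self]
        exact abs_pos.1 hxi
    · rw [mem_closedBall_zero_iff, pi_norm_le_iff_of_nonneg zero_le_one]
      intro j
      rw [Real.norm_eq_abs, abs_div, abs_abs]
      exact div_le_one_of_le₀ (hi _) hxi.le
    · simp only [f, hg, norm_smul, hx1, norm_inv, Real.norm_eq_abs, abs_abs, mul_one, inv_inv,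
        smul_smul, mul_inv_cancel₀ hxi.ne', one_smul]
  refine (measure_mono hcover).trans_lt ?_
  have hpiece (i : Fin (n + 1)) (s : ℝ) (hs : s ∈ ({1, -1} : Set ℝ)) :
      μH[(n : ℝ)] (f i s '' Metric.closedBall 0 1) < ⊤ := by
    have hg0 (v) : g i s v ≠ 0 := by
      intro h
      have h' := hgi i s v
      rw [h] at h'
      rcases hs with rfl | rfl <;> simp at h'
    have hg : ContDiff ℝ 1 (g i s) := by
      rw [contDiff_euclidean]
      intro k
      rcases Fin.eq_self_or_eq_succAbove i k with rfl | ⟨j, rfl⟩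
      · simp only [hgi]; fun_prop
      · simp only [hgs]; fun_prop
    have hf : ContDiff ℝ 1 (f i s) :=
      ((hg.norm ℝ hg0).inv fun v ↦ norm_ne_zero_iff.2 (hg0 v)).smul hg
    obtain ⟨K, hK⟩ := hf.contDiffOn.exists_lipschitzOnWith one_ne_zero
      (convex_closedBall (0 : Fin n → ℝ) 1) (isCompact_closedBall _ _)
    refine (hK.hausdorffMeasure_image_le n.cast_nonneg).trans_lt ?_
    refine ENNReal.mul_lt_top (by simp) ?_
    have := hausdorffMeasure_pi_real (ι := Fin n)
    rw [Fintype.card_fin] at this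
    rw [this]
    exact measure_closedBall_lt_top
  have h2 (i : Fin (n + 1)) :
      μH[(n : ℝ)] (⋃ s ∈ ({1, -1} : Set ℝ), f i s '' Metric.closedBall 0 1) < ⊤ :=
    measure_biUnion_lt_top (Set.toFinite _) (hpiece i)
  simpa using measure_biUnion_lt_top Set.finite_univ fun i _ ↦ h2 i

theorem hausdorffMeasure_sphere_ne_zero (n : ℕ) :
    μH[(n : ℝ)] (Metric.sphere (0 : EuclideanSpace ℝ (Fin (n + 1))) 1) ≠ 0 := by
  let p : EuclideanSpace ℝ (Fin (n + 1)) → Fin n → ℝ := fun x j ↦ x j.succ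
  have hp : LipschitzWith 1 p := by
    refine LipschitzWith.of_dist_le_mul fun x y ↦ ?_
    rw [NNReal.coe_one, one_mul, dist_pi_le_iff dist_nonneg]
    intro j
    rw [dist_eq_norm, dist_eq_norm]
    exact PiLp.norm_apply_le (x - y) j.succ
  have himage : Metric.ball 0 (1 / (n + 1 : ℝ)) ⊆ p '' Metric.sphere 0 1 := by
    intro v hv
    rw [mem_ball_zero_iff, pi_norm_lt_iff (by positivity)] at hv
    have hsum : ∑ j, v j ^ 2 ≤ 1 := by
      have hle : ∀ j, v j ^ 2 ≤ 1 / (n + 1 : ℝ) := fun j ↦ by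
        have h1 : |v j| ≤ 1 / (n + 1 : ℝ) := (hv j).le
        have h2 : 1 / (n + 1 : ℝ) ≤ 1 := by
          rw [div_le_one (by positivity)]; linarith [(n.cast_nonneg : (0 : ℝ) ≤ n)]
        nlinarith [sq_abs (v j), abs_nonneg (v j)]
      calc ∑ j, v j ^ 2 ≤ ∑ j : Fin n, 1 / (n + 1 : ℝ) := Finset.sum_le_sum fun j _ ↦ hle j
        _ ≤ 1 := by
          simp only [Finset.sum_const, Finset.card_univ, Fintype.card_fin, nsmul_eq_mul]
          rw [mul_one_div, div_le_one (by positivity)]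
          linarith
    refine ⟨WithLp.toLp 2 (Fin.cons (√(1 - ∑ j, v j ^ 2)) v), ?_, ?_⟩
    · rw [mem_sphere_zero_iff_norm, EuclideanSpace.norm_eq, Fin.sum_univ_succ]
      simp [Real.sq_sqrt (sub_nonneg.2 hsum)]
    · ext j
      simp [p]
  have hle := hp.hausdorffMeasure_image_le (d := n) n.cast_nonneg (Metric.sphere 0 1)
  have hvol := hausdorffMeasure_pi_real (ι := Fin n)
  rw [Fintype.card_fin] at hvol
  rw [hvol] at hle
  intro h0
  rw [h0, mul_zero, nonpos_iff_eq_zero] at hle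
  exact (Metric.measure_ball_pos volume (0 : Fin n → ℝ) (by positivity)).ne'
    (measure_mono_null himage hle)

section Polar

open scoped Pointwise

variable {E : Type*} [NormedAddCommGroup E] [MeasurableSpace E] [BorelSpace E]

theorem map_coe_toSphere_apply [NormedSpace ℝ E] (μ : Measure E) {s : Set E}
    (hs : MeasurableSet s) :
    μ.toSphere.map Subtype.val s =
      Module.finrank ℝ E * μ {x | (0 < ‖x‖ ∧ ‖x‖ < 1) ∧ ‖x‖⁻¹ • x ∈ s} := by
  rw [Measure.map_apply measurable_subtype_coe hs,
    μ.toSphere_apply' (measurable_subtype_coe hs)]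
  congr 2
  ext x
  rw [Set.mem_smul]
  constructor
  · rintro ⟨r, ⟨hr0, hr1⟩, _, ⟨l, hl, rfl⟩, rfl⟩
    have hn : ‖r • (l : E)‖ = r := by simp [norm_smul, abs_of_pos hr0]
    refine ⟨by rw [hn]; exact ⟨hr0, hr1⟩, ?_⟩
    rw [hn, inv_smul_smul₀ hr0.ne']
    exact hl
  · rintro ⟨⟨h0, h1⟩, hx⟩
    refine ⟨‖x‖, ⟨h0, h1⟩, ‖x‖⁻¹ • x, ⟨⟨‖x‖⁻¹ • x, ?_⟩, hx, rfl⟩, smul_inv_smul₀ h0.ne' x⟩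
    simp [norm_smul, h0.ne']

theorem measurePreserving_map_coe_toSphere [InnerProductSpace ℝ E] [FiniteDimensional ℝ E]
    (e : E ≃ₗᵢ[ℝ] E) :
    MeasurePreserving e ((volume : Measure E).toSphere.map Subtype.val)
      ((volume : Measure E).toSphere.map Subtype.val) := by
  have he : Measurable e := e.continuous.measurable
  refine ⟨he, Measure.ext fun s hs ↦ ?_⟩
  rw [Measure.map_apply he hs, map_coe_toSphere_apply _ hs, map_coe_toSphere_apply _ (he hs),
    ← e.measurePreserving.measure_preimage_equiv (f := e.toMeasurableEquiv)
      {x | (0 < ‖x‖ ∧ ‖x‖ < 1) ∧ ‖x‖⁻¹ • x ∈ s}]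
  congr 2
  ext x
  simp

/-- The measure of a set in polar coordinates. -/
theorem measure_eq_lintegral_toSphere [NormedSpace ℝ E] [FiniteDimensional ℝ E] [Nontrivial E]
    (μ : Measure E) [μ.IsAddHaarMeasure] {D : Set E} (hD : MeasurableSet D) :
    μ D = ∫⁻ l : Metric.sphere (0 : E) 1, Measure.volumeIoiPow (Module.finrank ℝ E - 1)
      {r | r.1 • (l : E) ∈ D} ∂μ.toSphere := by
  have hmp := μ.measurePreserving_homeomorphUnitSphereProd
  have hval : Measurable (Subtype.val : ({0}ᶜ : Set E) → E) := measurable_subtype_coe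
  have h0 : MeasurableSet ({0}ᶜ : Set E) := (measurableSet_singleton _).compl
  have h1 : μ D = μ.comap (Subtype.val : ({0}ᶜ : Set E) → E) (Subtype.val ⁻¹' D) := by
    rw [comap_subtype_coe_apply h0, Subtype.image_preimage_coe, Set.inter_comm,
      ← Set.sdiff_eq, measure_sdiff_null (measure_singleton _)]
  have hs : MeasurableSet ((homeomorphUnitSphereProd E).symm ⁻¹' (Subtype.val ⁻¹' D)) :=
    (homeomorphUnitSphereProd E).symm.continuous.measurable (hval hD)
  have h2 := hmp.measure_preimage hs.nullMeasurableSet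
  rw [Measure.prod_apply hs, ← Set.preimage_comp, Homeomorph.symm_comp_self, Set.preimage_id] at h2
  rw [h1, h2]
  rfl

theorem volumeIoiPow_pow_lt (n : ℕ) {t : ℝ} (ht : 0 ≤ t) :
    Measure.volumeIoiPow n {r | r.1 ^ (n + 1) < t} = ENNReal.ofReal (t / (n + 1)) := by
  rcases ht.eq_or_lt with rfl | ht
  · rw [zero_div, ENNReal.ofReal_zero]
    convert measure_empty (μ := Measure.volumeIoiPow n)
    ext r
    simpa using (pow_pos r.2.out (n + 1)).le
  · obtain ⟨s, hs, rfl⟩ : ∃ s : ℝ, 0 < s ∧ s ^ (n + 1) = t :=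
      ⟨t ^ ((n + 1 : ℕ) : ℝ)⁻¹, by positivity, Real.rpow_inv_natCast_pow ht.le (by simp)⟩
    rw [← Measure.volumeIoiPow_apply_Iio n ⟨s, hs⟩]
    congr 1
    ext r
    simp only [Set.mem_ofPred_eq, Set.mem_Iio]
    rw [pow_lt_pow_iff_left₀ r.2.out.le hs.le (by simp), ← Subtype.coe_lt_coe]

end Polar

theorem measurableSet_positive_orthant (M : ℕ) :
    MeasurableSet {x : EuclideanSpace ℝ (Fin M) | ∀ m, 0 < x m} := by
  rw [Set.ofPred_forall]
  exact MeasurableSet.iInter fun m ↦ measurableSet_lt measurable_const (by fun_prop)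

theorem two_pow_mul_volume_orthant_inter_ball (M : ℕ) :
    2 ^ M * volume {x : EuclideanSpace ℝ (Fin M) | (∀ m, 0 < x m) ∧ ‖x‖ < 1} =
      volume (Metric.ball (0 : EuclideanSpace ℝ (Fin M)) 1) := by
  let O : Set (EuclideanSpace ℝ (Fin M)) := {x | (∀ m, 0 < x m) ∧ ‖x‖ < 1}
  let e (s : Fin M → Bool) :
      EuclideanSpace ℝ (Fin M) ≃ₗᵢ[ℝ] EuclideanSpace ℝ (Fin M) :=
    LinearIsometryEquiv.piLpCongrRight 2 fun m ↦
      if s m then LinearIsometryEquiv.refl ℝ ℝ else LinearIsometryEquiv.neg ℝ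
  have he (s : Fin M → Bool) (x : EuclideanSpace ℝ (Fin M)) (m : Fin M) :
      e s x m = if s m then x m else -x m := by
    change (if s m then LinearIsometryEquiv.refl ℝ ℝ else LinearIsometryEquiv.neg ℝ) (x m) = _
    split_ifs <;> simp
  have hO : MeasurableSet O :=
    (measurableSet_positive_orthant M).inter (measurableSet_lt measurable_norm measurable_const)
  have hnull (m : Fin M) : volume {x : EuclideanSpace ℝ (Fin M) | x m = 0} = 0 :=
    (PiLp.volume_preserving_ofLp (Fin M)).quasiMeasurePreserving.preimage_null
      (Measure.pi_hyperplane (fun _ : Fin M ↦ (volume : Measure ℝ)) m 0)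
  have hunion : (⋃ s, e s ⁻¹' O : Set (EuclideanSpace ℝ (Fin M))) =ᵐ[volume]
      Metric.ball (0 : EuclideanSpace ℝ (Fin M)) 1 := by
    refine Filter.Eventually.set_eq ?_
    have : ∀ᵐ x : EuclideanSpace ℝ (Fin M), ∀ m, x m ≠ 0 := ae_all_iff.2 fun m ↦ by
      rw [ae_iff]; simpa using hnull m
    filter_upwards [this] with x hx
    simp only [Set.mem_iUnion, Set.mem_preimage, mem_ball_zero_iff]
    constructor
    · rintro ⟨s, -, h⟩
      simpa using h
    · intro h
      refine ⟨fun m ↦ decide (0 < x m), fun m ↦ ?_, by simpa using h⟩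
      rw [he]
      by_cases hm : 0 < x m
      · simp [hm]
      · simpa [hm] using lt_of_le_of_ne (not_lt.1 hm) (hx m)
  have hdisj : Pairwise (Function.onFun Disjoint fun s ↦
      (e s ⁻¹' O : Set (EuclideanSpace ℝ (Fin M)))) := by
    intro s t hst
    refine Set.disjoint_left.2 fun x hs ht ↦ hst (funext fun m ↦ ?_)
    have h1 := hs.1 m
    have h2 := ht.1 m
    rw [he] at h1 h2
    cases hsm : s m <;> cases htm : t m <;> simp [hsm, htm] at h1 h2 ⊢ <;> linarith
  rw [← measure_congr hunion, measure_iUnion hdisj fun s ↦ (e s).continuous.measurable hO]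
  simp only [(e _).measurePreserving.measure_preimage hO.nullMeasurableSet]
  simp [O]

/-- Up to a null set, the dominated region is a translate of a union of open boxes in the positive
orthant. -/
theorem volume_dominatedRegion_eq (M : ℕ) (Y : Finset (EuclideanSpace ℝ (Fin M)))
    (η : EuclideanSpace ℝ (Fin M)) :
    volume (⋃ y ∈ Y, {z : EuclideanSpace ℝ (Fin M) | ∀ m, η m ≤ z m ∧ z m ≤ y m}) =
      volume (⋃ y ∈ Y, {z : EuclideanSpace ℝ (Fin M) | ∀ m, 0 < z m ∧ z m < y m - η m}) := by
  have hbox (y : EuclideanSpace ℝ (Fin M)) :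
      ({z | ∀ m, η m ≤ z m ∧ z m ≤ y m} : Set (EuclideanSpace ℝ (Fin M))) =ᵐ[volume]
        {z | ∀ m, η m < z m ∧ z m < y m} := by
    have h := (PiLp.volume_preserving_ofLp (Fin M)).quasiMeasurePreserving.preimage_ae_eq
      (Measure.univ_pi_Ioo_ae_eq_Icc (μ := fun _ : Fin M ↦ (volume : Measure ℝ))
        (f := η.ofLp) (g := y.ofLp))
    have h₁ : (WithLp.ofLp ⁻¹' Set.Icc η.ofLp y.ofLp : Set (EuclideanSpace ℝ (Fin M))) =
        {z | ∀ m, η m ≤ z m ∧ z m ≤ y m} := by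
      ext z; simp [Pi.le_def, forall_and]
    have h₂ : (WithLp.ofLp ⁻¹' (Set.univ.pi fun m ↦ Set.Ioo (η.ofLp m) (y.ofLp m)) :
        Set (EuclideanSpace ℝ (Fin M))) = {z | ∀ m, η m < z m ∧ z m < y m} := by
      ext z; simp
    rw [h₁, h₂] at h
    exact h.symm
  have hY := Filter.EventuallyEq.countable_bUnion Y.countable_toSet fun y _ ↦ hbox y
  refine (measure_congr hY).trans ?_
  rw [← measure_preimage_add volume η]
  congr 1
  ext z
  simp [lt_sub_iff_add_lt']

theorem normalized_smul_measure {α : Type*} [MeasurableSpace α] {μ : Measure α} {c : ENNReal}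
    (hc0 : c ≠ 0) (hc : c ≠ ⊤) : ((c • μ) Set.univ)⁻¹ • (c • μ) = (μ Set.univ)⁻¹ • μ := by
  rw [Measure.smul_apply, smul_smul, smul_eq_mul, ENNReal.mul_inv (.inl hc0) (.inl hc), mul_comm,
    ← mul_assoc, ENNReal.mul_inv_cancel hc0 hc, one_mul]

/-- Hausdorff measure on the Euclidean unit sphere is a positive multiple of the cone measure
`volume.toSphere`. -/
theorem exists_hausdorffMeasure_restrict_sphere_eq (n : ℕ) :
    ∃ c : ENNReal, c ≠ 0 ∧ c ≠ ⊤ ∧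
      (μH[(n : ℝ)]).restrict (Metric.sphere (0 : EuclideanSpace ℝ (Fin (n + 1))) 1) =
        c • (volume : Measure (EuclideanSpace ℝ (Fin (n + 1)))).toSphere.map Subtype.val := by
  set S := Metric.sphere (0 : EuclideanSpace ℝ (Fin (n + 1))) 1
  set ν := (μH[(n : ℝ)]).restrict S
  set τ := (volume : Measure (EuclideanSpace ℝ (Fin (n + 1)))).toSphere.map Subtype.val with hτ
  have hS : MeasurableSet S := Metric.isClosed_sphere.measurableSet
  have hνS : ∀ᵐ x ∂ν, x ∈ S := ae_restrict_mem hS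
  have hτS : ∀ᵐ x ∂τ, x ∈ S :=
    (ae_map_iff measurable_subtype_coe.aemeasurable hS).2 (ae_of_all _ fun x ↦ x.2)
  have hνtop : ν Set.univ ≠ ⊤ := by
    rw [Measure.restrict_apply_univ]
    exact (hausdorffMeasure_sphere_lt_top n).ne
  have hν0 : ν Set.univ ≠ 0 := by
    rw [Measure.restrict_apply_univ]
    exact hausdorffMeasure_sphere_ne_zero n
  have : IsFiniteMeasure ν := ⟨hνtop.lt_top⟩
  have hτtop : τ Set.univ ≠ ⊤ := measure_ne_top _ _
  have hτ0 : τ Set.univ ≠ 0 := by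
    rw [hτ, Measure.map_apply measurable_subtype_coe .univ, Set.preimage_univ, Ne,
      Measure.measure_univ_eq_zero]
    exact Measure.toSphere_ne_zero _
  have hνe (e : EuclideanSpace ℝ (Fin (n + 1)) ≃ₗᵢ[ℝ] EuclideanSpace ℝ (Fin (n + 1))) :
      MeasurePreserving e ν ν := by
    have h := (e.toIsometryEquiv.measurePreserving_hausdorffMeasure n).restrict_preimage hS
    have hpre : e.toIsometryEquiv ⁻¹' S = S := by
      ext x
      simp [S]
    rwa [hpre] at h
  have key := smul_eq_smul_of_uniformlyDistributed hνS hτS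
    (fun x hx y hy ↦ measure_ball_eq_of_forall_measurePreserving hνe
      ((mem_sphere_zero_iff_norm.1 hx).trans (mem_sphere_zero_iff_norm.1 hy).symm))
    (fun x hx y hy ↦ measure_ball_eq_of_forall_measurePreserving measurePreserving_map_coe_toSphere
      ((mem_sphere_zero_iff_norm.1 hx).trans (mem_sphere_zero_iff_norm.1 hy).symm))
  refine ⟨(τ Set.univ)⁻¹ * ν Set.univ, mul_ne_zero (ENNReal.inv_ne_zero.2 hτtop) hν0,
    ENNReal.mul_ne_top (ENNReal.inv_ne_top.2 hτ0) hνtop, ?_⟩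
  rw [mul_smul, ← key, smul_smul, ENNReal.inv_mul_cancel hτ0 hτtop, one_smul]

theorem normalized_hausdorffMeasure_restrict_eq (n : ℕ)
    {P : Set (EuclideanSpace ℝ (Fin (n + 1)))} (hP : P ⊆ Metric.sphere 0 1) :
    (((μH[(n : ℝ)]).restrict P) Set.univ)⁻¹ • (μH[(n : ℝ)]).restrict P =
      ((((volume : Measure (EuclideanSpace ℝ (Fin (n + 1)))).toSphere.map Subtype.val).restrict P)
        Set.univ)⁻¹ •
        ((volume : Measure (EuclideanSpace ℝ (Fin (n + 1)))).toSphere.map Subtype.val).restrict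
          P := by
  obtain ⟨c, hc0, hc, h⟩ := exists_hausdorffMeasure_restrict_sphere_eq n
  rw [← Measure.restrict_restrict_of_subset hP, h, Measure.restrict_smul,
    normalized_smul_measure hc0 hc]

theorem map_coe_toSphere_orthant (n : ℕ) :
    (volume : Measure (EuclideanSpace ℝ (Fin (n + 1)))).toSphere.map Subtype.val
      {l | (∀ m, 0 < l m) ∧ ‖l‖ = 1} =
      ENNReal.ofReal ((n + 1) * (Real.pi ^ (((n + 1 : ℕ) : ℝ) / 2) /
        (2 ^ (n + 1) * Real.Gamma (((n + 1 : ℕ) : ℝ) / 2 + 1)))) := by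
  have hP : MeasurableSet {l : EuclideanSpace ℝ (Fin (n + 1)) | (∀ m, 0 < l m) ∧ ‖l‖ = 1} :=
    (measurableSet_positive_orthant (n + 1)).inter
      (measurableSet_eq_fun measurable_norm measurable_const)
  have hcone : {x : EuclideanSpace ℝ (Fin (n + 1)) | (0 < ‖x‖ ∧ ‖x‖ < 1) ∧
      ‖x‖⁻¹ • x ∈ {l : EuclideanSpace ℝ (Fin (n + 1)) | (∀ m, 0 < l m) ∧ ‖l‖ = 1}} =
      {x | (∀ m, 0 < x m) ∧ ‖x‖ < 1} := by
    ext x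
    constructor
    · rintro ⟨⟨h0, h1⟩, h2, -⟩
      refine ⟨fun m ↦ ?_, h1⟩
      simpa [h0.ne', h0] using h2 m
    · rintro ⟨h0, h1⟩
      have hx : 0 < ‖x‖ := norm_pos_iff.2 fun h ↦ by simpa [h] using h0 0
      refine ⟨⟨hx, h1⟩, fun m ↦ ?_, by simp [norm_smul, hx.ne']⟩
      simpa [hx] using mul_pos (inv_pos.2 hx) (h0 m)
  have hvol := two_pow_mul_volume_orthant_inter_ball (n + 1)
  rw [EuclideanSpace.volume_ball, Fintype.card_fin, ENNReal.ofReal_one, one_pow, one_mul] at hvol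
  have hpi : Real.pi ^ (((n + 1 : ℕ) : ℝ) / 2) = √Real.pi ^ (n + 1) := by
    rw [Real.sqrt_eq_rpow, ← Real.rpow_mul_natCast Real.pi_pos.le]
    congr 1
    ring
  have h2 : (2 : ENNReal) ^ (n + 1) = ENNReal.ofReal (2 ^ (n + 1)) := by
    rw [ENNReal.ofReal_pow zero_le_two]; simp
  have hG : 0 < Real.Gamma (((n + 1 : ℕ) : ℝ) / 2 + 1) := Real.Gamma_pos_of_pos (by positivity)
  rw [map_coe_toSphere_apply _ hP, hcone, finrank_euclideanSpace, Fintype.card_fin, hpi,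
    ENNReal.ofReal_mul (by positivity)]
  congr 1
  · rw [← ENNReal.ofReal_natCast]; simp
  · rw [← ENNReal.mul_right_inj (a := 2 ^ (n + 1)) (by simp) (by simp), hvol, h2,
      ← ENNReal.ofReal_mul (by positivity)]
    congr 1
    field_simp

theorem measurable_scalarisation {n : ℕ} (Y : Finset (EuclideanSpace ℝ (Fin (n + 1))))
    (hY : Y.Nonempty) (η : EuclideanSpace ℝ (Fin (n + 1))) (C : ℝ) :
    Measurable fun l : EuclideanSpace ℝ (Fin (n + 1)) ↦ Y.sup' hY fun y ↦
      C * Finset.univ.inf' Finset.univ_nonempty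
        fun m ↦ (max 0 (y m - η m) / l m) ^ (n + 1) := by
  have hinf (y : EuclideanSpace ℝ (Fin (n + 1))) :
      Measurable fun l : EuclideanSpace ℝ (Fin (n + 1)) ↦
        Finset.univ.inf' Finset.univ_nonempty
          fun m ↦ (max 0 (y m - η m) / l m) ^ (n + 1) := by
    convert Finset.inf'_induction (Finset.univ_nonempty (α := Fin (n + 1)))
      (p := Measurable)
      (f := fun m (l : EuclideanSpace ℝ (Fin (n + 1))) ↦ (max 0 (y m - η m) / l m) ^ (n + 1))
      (fun _ h₁ _ h₂ ↦ h₁.inf h₂) (fun m _ ↦ by fun_prop) using 1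
    ext l
    rw [Finset.inf'_apply]
  convert Finset.measurable_sup' hY (fun y _ ↦ (hinf y).const_mul C) using 1
  ext l
  rw [Finset.sup'_apply]

theorem scalarisation_nonneg {n : ℕ} (Y : Finset (EuclideanSpace ℝ (Fin (n + 1))))
    (hY : Y.Nonempty) (η : EuclideanSpace ℝ (Fin (n + 1))) {C : ℝ} (hC : 0 ≤ C)
    {l : EuclideanSpace ℝ (Fin (n + 1))} (hl : ∀ m, 0 < l m) :
    0 ≤ Y.sup' hY fun y ↦ C * Finset.univ.inf' Finset.univ_nonempty
      fun m ↦ (max 0 (y m - η m) / l m) ^ (n + 1) := by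
  obtain ⟨y, hy⟩ := hY
  refine (mul_nonneg hC ?_).trans (Finset.le_sup' (f := fun y : EuclideanSpace ℝ (Fin (n + 1)) ↦
    C * Finset.univ.inf' Finset.univ_nonempty fun m ↦ (max 0 (y m - η m) / l m) ^ (n + 1)) hy)
  exact Finset.le_inf' _ _ fun m _ ↦ pow_nonneg (div_nonneg (le_max_left _ _) (hl m).le) _

theorem volume_dominatedRegion_eq_lintegral (n : ℕ)
    (Y : Finset (EuclideanSpace ℝ (Fin (n + 1)))) (hY : Y.Nonempty)
    (η : EuclideanSpace ℝ (Fin (n + 1))) {C : ℝ} (hC : 0 < C) :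
    volume (⋃ y ∈ Y, {z : EuclideanSpace ℝ (Fin (n + 1)) | ∀ m, η m ≤ z m ∧ z m ≤ y m}) =
      ENNReal.ofReal ((n + 1) * C)⁻¹ *
        ∫⁻ l in {l : EuclideanSpace ℝ (Fin (n + 1)) | (∀ m, 0 < l m) ∧ ‖l‖ = 1},
          ENNReal.ofReal (Y.sup' hY fun y ↦ C * Finset.univ.inf' Finset.univ_nonempty
            fun m ↦ (max 0 (y m - η m) / l m) ^ (n + 1))
          ∂(volume : Measure (EuclideanSpace ℝ (Fin (n + 1)))).toSphere.map Subtype.val := by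
  set P := {l : EuclideanSpace ℝ (Fin (n + 1)) | (∀ m, 0 < l m) ∧ ‖l‖ = 1}
  set F : EuclideanSpace ℝ (Fin (n + 1)) → ℝ := fun l ↦ Y.sup' hY fun y ↦
    C * Finset.univ.inf' Finset.univ_nonempty fun m ↦ (max 0 (y m - η m) / l m) ^ (n + 1)
  have hFm : Measurable F := measurable_scalarisation Y hY η C
  have hP : MeasurableSet P := (measurableSet_positive_orthant (n + 1)).inter
    (measurableSet_eq_fun measurable_norm measurable_const)
  have hD : MeasurableSet (⋃ y ∈ Y,
      {z : EuclideanSpace ℝ (Fin (n + 1)) | ∀ m, 0 < z m ∧ z m < y m - η m}) := by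
    refine Y.measurableSet_biUnion fun y _ ↦ ?_
    rw [Set.ofPred_forall]
    refine MeasurableSet.iInter fun m ↦ ?_
    have hm : Measurable fun z : EuclideanSpace ℝ (Fin (n + 1)) ↦ z m := by fun_prop
    exact (measurableSet_lt measurable_const hm).inter (measurableSet_lt hm measurable_const)
  rw [volume_dominatedRegion_eq, measure_eq_lintegral_toSphere volume hD,
    ← lintegral_const_mul _ hFm.ennreal_ofReal, ← lintegral_indicator hP,
    lintegral_map ((hFm.ennreal_ofReal.const_mul _).indicator hP) measurable_subtype_coe,
    finrank_euclideanSpace, Fintype.card_fin, Nat.add_sub_cancel]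
  refine lintegral_congr fun l ↦ ?_
  by_cases hl : (l : EuclideanSpace ℝ (Fin (n + 1))) ∈ P
  · rw [Set.indicator_of_mem hl, ← ENNReal.ofReal_mul (by positivity), mul_inv, mul_assoc,
      mul_comm, ← div_eq_mul_inv, ← volumeIoiPow_pow_lt n
      (mul_nonneg (by positivity) (scalarisation_nonneg Y hY η hC.le hl.1))]
    congr 1
    ext ⟨r, hr⟩
    have hr : 0 < r := hr
    simp only [Set.mem_iUnion, Set.mem_ofPred_eq, exists_prop, PiLp.smul_apply, smul_eq_mul]
    rw [← div_eq_inv_mul, lt_div_iff₀' hC, Finset.lt_sup'_iff]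
    refine exists_congr fun y ↦ and_congr_right fun _ ↦ ?_
    rw [mul_lt_mul_iff_right₀ hC, Finset.lt_inf'_iff]
    refine ⟨fun h m _ ↦ ?_, fun h m ↦ ?_⟩
    · refine pow_lt_pow_left₀ ?_ hr.le (by simp)
      rw [lt_div_iff₀ (hl.1 m)]
      exact lt_max_of_lt_right (h m).2
    · have hpos := mul_pos hr (hl.1 m)
      refine ⟨hpos, ?_⟩
      have hlt := lt_of_pow_lt_pow_left₀ _
        (div_nonneg (le_max_left _ _) (hl.1 m).le) (h m (Finset.mem_univ m))
      rw [lt_div_iff₀ (hl.1 m)] at hlt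
      exact (lt_max_iff.1 hlt).resolve_left hpos.not_gt
  · rw [Set.indicator_of_notMem hl]
    convert measure_empty (μ := Measure.volumeIoiPow n)
    ext ⟨r, hr⟩
    have hr : 0 < r := hr
    simp only [Set.mem_iUnion, Set.mem_ofPred_eq, exists_prop, PiLp.smul_apply, smul_eq_mul,
      Set.mem_empty_iff_false, iff_false]
    rintro ⟨y, -, h⟩
    exact hl ⟨fun m ↦ pos_of_mul_pos_right (h m).1 hr.le, mem_sphere_zero_iff_norm.1 l.2⟩

/-- The hypervolume indicator of a nonempty finite set `Y ⊆ ℝ^M` with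
reference point `η` equals the expectation, over `λ` uniformly distributed on the
positive part of the unit sphere, of the maximal hypervolume scalarisation
`s^{HV}_{(η,λ)}(y) = (π^{M/2} / (2^M Γ(M/2 + 1))) min_m (max(0, y_m − η_m)/λ_m)^M`.
The uniform distribution is the `(M−1)`-dimensional Hausdorff (surface) measure
restricted to the positive part of the unit sphere and normalised to a probability
measure. -/
theorem hypervolume_eq_r2_utility
    (M : ℕ) (hM : 1 ≤ M)
    (Y : Finset (EuclideanSpace ℝ (Fin M))) (hY : Y.Nonempty)
    (η : EuclideanSpace ℝ (Fin M)) :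
    (volume (⋃ y ∈ Y, {z : EuclideanSpace ℝ (Fin M) | ∀ m, η m ≤ z m ∧ z m ≤ y m})).toReal
      = ∫ l, Y.sup' hY (fun y =>
            (Real.pi ^ ((M : ℝ) / 2) / (2 ^ M * Real.Gamma ((M : ℝ) / 2 + 1))) *
            Finset.univ.inf' (Finset.univ_nonempty_iff.mpr ⟨⟨0, hM⟩⟩)
              (fun m : Fin M => (max 0 (y m - η m) / l m) ^ M))
          ∂((((μH[(M : ℝ) - 1]).restrict
                {l : EuclideanSpace ℝ (Fin M) | (∀ m, 0 < l m) ∧ ‖l‖ = 1}) Set.univ)⁻¹ •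
              ((μH[(M : ℝ) - 1]).restrict
                {l : EuclideanSpace ℝ (Fin M) | (∀ m, 0 < l m) ∧ ‖l‖ = 1})) := by
  obtain ⟨n, rfl⟩ : ∃ n, M = n + 1 := ⟨M - 1, by omega⟩
  set C : ℝ := Real.pi ^ (((n + 1 : ℕ) : ℝ) / 2) /
    (2 ^ (n + 1) * Real.Gamma (((n + 1 : ℕ) : ℝ) / 2 + 1))
  have hC : 0 < C := by
    have hG : 0 < Real.Gamma (((n + 1 : ℕ) : ℝ) / 2 + 1) := Real.Gamma_pos_of_pos (by positivity)
    have := Real.pi_pos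
    positivity
  have hP : MeasurableSet {l : EuclideanSpace ℝ (Fin (n + 1)) | (∀ m, 0 < l m) ∧ ‖l‖ = 1} :=
    (measurableSet_positive_orthant (n + 1)).inter
      (measurableSet_eq_fun measurable_norm measurable_const)
  have hd : ((n + 1 : ℕ) : ℝ) - 1 = n := by push_cast; ring
  rw [hd, normalized_hausdorffMeasure_restrict_eq n fun l hl ↦ mem_sphere_zero_iff_norm.2 hl.2,
    integral_smul_measure, Measure.restrict_apply_univ, map_coe_toSphere_orthant,
    integral_eq_lintegral_of_nonneg_ae
      ((ae_restrict_mem hP).mono fun l hl ↦ scalarisation_nonneg Y hY η hC.le hl.1)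
      (measurable_scalarisation Y hY η C).aestronglyMeasurable,
    volume_dominatedRegion_eq_lintegral n Y hY η hC, ENNReal.toReal_mul, smul_eq_mul,
    ENNReal.toReal_inv, ENNReal.toReal_ofReal (by positivity),
    ENNReal.toReal_ofReal (by positivity)]
end

section
/- Let Ω be a type and U a set function on finite subsets of Ω that is monotone, submodular and satisfies U(∅) ≥ 0. Let X_0 = ∅ and X_n = X_{n−1} ∪ {x_n} for n ≥ 1, where each x_n ∈ Ω is chosen greedily: U(X_{n−1} ∪ {x_n}) − U(X_{n−1}) ≥ U(X_{n−1} ∪ {x}) − U(X_{n−1}) for all x ∈ Ω. Then for all positive integers P and N and every finite subset X ⊆ Ω with |X| ≤ P, one has U(X_N) ≥ (1 − e^{−N/P}) U(X). -/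
/-- If `U` has diminishing marginal gains and every one-element gain over `A` is at most `g`,
then adding a set `S` to `A` gains at most `S.card * g`. -/
theorem sub_le_card_mul_of_marginal_le {Ω : Type*} [DecidableEq Ω] {U : Finset Ω → ℝ}
    (hsub : ∀ A B : Finset Ω, A ⊆ B → ∀ c : Ω,
      U (insert c B) - U B ≤ U (insert c A) - U A)
    {A : Finset Ω} {g : ℝ} (hg : ∀ c : Ω, U (insert c A) - U A ≤ g) (S : Finset Ω) :
    U (A ∪ S) - U A ≤ S.card * g := by
  induction S using Finset.induction_on with
  | empty => simp
  | insert c S hc ih =>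
    rw [Finset.union_insert, Finset.card_insert_of_notMem hc]
    push_cast
    linarith [hsub A (A ∪ S) Finset.subset_union_left c, hg c]

/-- The Nemhauser-Wolsey-Fisher greedy guarantee: for a monotone submodular
set function `U` with `U ∅ ≥ 0`, the greedy sequence `X_N` satisfies
`U(X_N) ≥ (1 − e^{−N/P}) U(X)` for every set `X` of cardinality at most `P`. -/
theorem greedy_guarantee
    {Ω : Type*} [DecidableEq Ω] (U : Finset Ω → ℝ)
    (hmono : ∀ A B : Finset Ω, A ⊆ B → U A ≤ U B)
    (hsub : ∀ A B : Finset Ω, A ⊆ B → ∀ c : Ω,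
      U (insert c B) - U B ≤ U (insert c A) - U A)
    (h0 : 0 ≤ U ∅)
    (x : ℕ → Ω) (X : ℕ → Finset Ω)
    (hX0 : X 0 = ∅)
    (hXsucc : ∀ n : ℕ, X (n + 1) = insert (x (n + 1)) (X n))
    (hgreedy : ∀ n : ℕ, ∀ x' : Ω,
      U (insert x' (X n)) - U (X n) ≤ U (insert (x (n + 1)) (X n)) - U (X n))
    (P N : ℕ) (hP : 1 ≤ P) (hN : 1 ≤ N)
    (Xstar : Finset Ω) (hcard : Xstar.card ≤ P) :
    (1 - Real.exp (-(N : ℝ) / (P : ℝ))) * U Xstar ≤ U (X N) := by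
  have hP0 : (0 : ℝ) < P := by exact_mod_cast hP
  have hP1 : (0 : ℝ) ≤ 1 - 1 / P := by
    rw [sub_nonneg, div_le_one hP0]
    exact_mod_cast hP
  have hU : 0 ≤ U Xstar := h0.trans (hmono _ _ (Finset.empty_subset _))
  have gap_step (n : ℕ) : U Xstar - U (X (n + 1)) ≤ (1 - 1 / P) * (U Xstar - U (X n)) := by
    have hgain : 0 ≤ U (X (n + 1)) - U (X n) := by
      rw [hXsucc, sub_nonneg]
      exact hmono _ _ (Finset.subset_insert _ _)
    have hgap : U Xstar - U (X n) ≤ P * (U (X (n + 1)) - U (X n)) := calc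
      U Xstar - U (X n) ≤ U (X n ∪ Xstar) - U (X n) :=
        sub_le_sub_right (hmono _ _ Finset.subset_union_right) _
      _ ≤ Xstar.card * (U (X (n + 1)) - U (X n)) :=
        sub_le_card_mul_of_marginal_le hsub (fun c => by rw [hXsucc]; exact hgreedy n c) Xstar
      _ ≤ P * (U (X (n + 1)) - U (X n)) := by gcongr
    have hdiv : (U Xstar - U (X n)) / P ≤ U (X (n + 1)) - U (X n) :=
      (div_le_iff₀' hP0).mpr hgap
    calc U Xstar - U (X (n + 1)) ≤ U Xstar - U (X n) - (U Xstar - U (X n)) / P := by linarith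
      _ = (1 - 1 / P) * (U Xstar - U (X n)) := by ring
  have gap_le (n : ℕ) : U Xstar - U (X n) ≤ (1 - 1 / P) ^ n * U Xstar := by
    induction n with
    | zero => simpa [hX0] using h0
    | succ n ih =>
      rw [pow_succ', mul_assoc]
      exact (gap_step n).trans (mul_le_mul_of_nonneg_left ih hP1)
  have hexp : (1 - 1 / (P : ℝ)) ^ N ≤ Real.exp (-(N : ℝ) / (P : ℝ)) := calc
    (1 - 1 / (P : ℝ)) ^ N ≤ Real.exp (-(1 / (P : ℝ))) ^ N :=
      pow_le_pow_left₀ hP1 (Real.one_sub_le_exp_neg _) N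
    _ = Real.exp (-(N : ℝ) / (P : ℝ)) := by
      rw [← Real.exp_nat_mul]
      congr 1
      ring
  linarith [gap_le N, mul_le_mul_of_nonneg_right hexp hU]
end

section
/- Let P ≥ 1 and N ≥ 1 be integers, u : ℕ → ℝ, ρ : ℕ → ℝ and u* ∈ ℝ with u(0) ≥ 0 and u* ≥ 0. Suppose that for all 0 ≤ n < N, u* ≤ u(n) + P (u(n+1) − u(n)) + P ρ(n+1). Then u(N) ≥ (1 − e^{−N/P}) u* − Σ_{n=1}^{N} ρ(n) (1 − 1/P)^{N−n}. -/
/-- A sequence with `z (n + 1) ≤ r * z n + b (n + 1)` and `0 ≤ r` is dominated by the solution of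
the corresponding affine recursion. -/
theorem le_of_affine_recursion {r : ℝ} (hr : 0 ≤ r) {z b : ℕ → ℝ} {N : ℕ}
    (h : ∀ n < N, z (n + 1) ≤ r * z n + b (n + 1)) :
    z N ≤ r ^ N * z 0 + ∑ n ∈ Finset.Icc 1 N, b n * r ^ (N - n) := by
  induction N with
  | zero => simp
  | succ N ih =>
    have hsum : ∑ n ∈ Finset.Icc 1 N, b n * r ^ (N + 1 - n) =
        r * ∑ n ∈ Finset.Icc 1 N, b n * r ^ (N - n) := by
      rw [Finset.mul_sum]
      refine Finset.sum_congr rfl fun n hn => ?_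
      rw [Nat.sub_add_comm (Finset.mem_Icc.mp hn).2, pow_succ]
      ring
    rw [Finset.sum_Icc_succ_top (by omega), hsum, Nat.sub_self, pow_zero, mul_one, pow_succ]
    have hz := mul_le_mul_of_nonneg_left (ih fun n hn => h n (by omega)) hr
    linarith [h N N.lt_succ_self]

/-- Unlike `Real.one_sub_div_pow_le_exp_neg`, the exponent is independent of the denominator. -/
theorem one_sub_one_div_pow_le_exp_neg_div (P N : ℕ) :
    (1 - 1 / (P : ℝ)) ^ N ≤ Real.exp (-(N : ℝ) / (P : ℝ)) := by
  have hr : (0 : ℝ) ≤ 1 - 1 / P := Nat.one_sub_one_div_cast_nonneg P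
  calc (1 - 1 / (P : ℝ)) ^ N ≤ Real.exp (-(1 / (P : ℝ))) ^ N :=
        pow_le_pow_left₀ hr (Real.one_sub_le_exp_neg _) N
    _ = Real.exp (-(N : ℝ) / (P : ℝ)) := by
        rw [← Real.exp_nat_mul]
        ring_nf

/-- The deterministic recursion underlying greedy performance bounds:
if `u* ≤ u(n) + P (u(n+1) − u(n)) + P ρ(n+1)` for all `0 ≤ n < N`, with `u(0) ≥ 0` and
`u* ≥ 0`, then `u(N) ≥ (1 − e^{−N/P}) u* − Σ_{n=1}^{N} ρ(n) (1 − 1/P)^{N−n}`. -/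
theorem greedy_recursion_bound
    (P N : ℕ) (hP : 1 ≤ P) (hN : 1 ≤ N)
    (u ρ : ℕ → ℝ) (ustar : ℝ)
    (hu0 : 0 ≤ u 0) (hustar : 0 ≤ ustar)
    (hrec : ∀ n : ℕ, n < N →
      ustar ≤ u n + (P : ℝ) * (u (n + 1) - u n) + (P : ℝ) * ρ (n + 1)) :
    (1 - Real.exp (-(N : ℝ) / (P : ℝ))) * ustar -
        ∑ n ∈ Finset.Icc 1 N, ρ n * (1 - 1 / (P : ℝ)) ^ (N - n) ≤ u N := by
  have hP0 : (0 : ℝ) < P := by exact_mod_cast hP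
  have hr : (0 : ℝ) ≤ 1 - 1 / P := Nat.one_sub_one_div_cast_nonneg P
  have hstep : ∀ n < N, ustar - u (n + 1) ≤ (1 - 1 / (P : ℝ)) * (ustar - u n) + ρ (n + 1) := by
    intro n hn
    have h : (ustar - u n) / P ≤ u (n + 1) - u n + ρ (n + 1) := by
      rw [div_le_iff₀ hP0]
      linarith [hrec n hn]
    linarith [one_div_mul_eq_div (P : ℝ) (ustar - u n)]
  have hN' := le_of_affine_recursion (z := fun n => ustar - u n) hr hstep
  have hexp := mul_le_mul_of_nonneg_right (one_sub_one_div_pow_le_exp_neg_div P N) hustar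
  have hu := mul_nonneg (pow_nonneg hr N) hu0
  linarith
end

section
/- Let Ω be a type and U a set function on finite subsets of Ω that is monotone and submodular. Let X and X* be finite subsets of Ω with X* nonempty and |X*| ≤ P for a positive integer P. Then U(X*) ≤ U(X) + P · max_{x ∈ X*} ( U(X ∪ {x}) − U(X) ). -/
/-- For a submodular set function, the gain from adjoining a finite set is at most the sum of the
gains from adjoining its elements one at a time. -/
theorem submodular_union_le_add_sum
    {Ω : Type*} [DecidableEq Ω] (U : Finset Ω → ℝ)
    (hsub : ∀ A B : Finset Ω, A ⊆ B → ∀ c : Ω,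
      U (insert c B) - U B ≤ U (insert c A) - U A)
    (X S : Finset Ω) :
    U (X ∪ S) ≤ U X + ∑ x ∈ S, (U (insert x X) - U X) := by
  induction S using Finset.induction_on with
  | empty => simp
  | insert a S ha ih =>
    rw [Finset.sum_insert ha, Finset.union_insert]
    have := hsub X (X ∪ S) Finset.subset_union_left a
    linarith

/-- For a monotone submodular set function `U`, any finite set `X` and any
nonempty finite set `X*` with `|X*| ≤ P`, one has
`U(X*) ≤ U(X) + P · max_{x ∈ X*} (U(X ∪ {x}) − U(X))`. -/
theorem submodular_optimal_bound
    {Ω : Type*} [DecidableEq Ω] (U : Finset Ω → ℝ)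
    (hmono : ∀ A B : Finset Ω, A ⊆ B → U A ≤ U B)
    (hsub : ∀ A B : Finset Ω, A ⊆ B → ∀ c : Ω,
      U (insert c B) - U B ≤ U (insert c A) - U A)
    (X Xstar : Finset Ω) (hne : Xstar.Nonempty)
    (P : ℕ) (hP : 1 ≤ P) (hcard : Xstar.card ≤ P) :
    U Xstar ≤ U X + (P : ℝ) * Xstar.sup' hne (fun x => U (insert x X) - U X) := by
  set M := Xstar.sup' hne (fun x => U (insert x X) - U X)
  have hle : ∀ x ∈ Xstar, U (insert x X) - U X ≤ M := fun x hx =>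
    Finset.le_sup' (fun x => U (insert x X) - U X) hx
  have hM : 0 ≤ M := by
    obtain ⟨x, hx⟩ := hne
    exact (sub_nonneg.2 (hmono _ _ (Finset.subset_insert x X))).trans (hle x hx)
  calc U Xstar ≤ U (X ∪ Xstar) := hmono _ _ Finset.subset_union_right
    _ ≤ U X + ∑ x ∈ Xstar, (U (insert x X) - U X) := submodular_union_le_add_sum U hsub X Xstar
    _ ≤ U X + Xstar.card * M := by
      rw [← nsmul_eq_mul]
      gcongr
      exact Finset.sum_le_card_nsmul _ _ _ hle
    _ ≤ U X + P * M := by gcongr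
end

section
/- Let Y be a nonempty finite subset of ℝ^M and let Y* = { y ∈ Y : there is no y' ∈ Y with y' ≻ y } be the set of strictly Pareto optimal (maximal) elements of Y. Then Y* is nonempty, and for every utility function U on nonempty finite subsets of ℝ^M that is weakly Pareto compliant, one has U(Y*) ≥ U(A) for every nonempty subset A ⊆ Y; in particular max_{A ⊆ Y, A ≠ ∅} U(A) = U(Y*). -/
/-- The set `Y*` of strictly Pareto optimal (maximal) elements of a nonempty
finite set `Y ⊆ ℝ^M` is nonempty, and any weakly Pareto compliant utility `U` attains its
maximum over nonempty subsets of `Y` at `Y*`. -/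
theorem pareto_optimal_subset_maximises_compliant_utility
    {M : ℕ} (Y Ystar : Finset (Fin M → ℝ)) (hY : Y.Nonempty)
    (hYstar : ∀ y : Fin M → ℝ,
      y ∈ Ystar ↔ y ∈ Y ∧ ¬ ∃ y' ∈ Y, (∀ m, y m ≤ y' m) ∧ y' ≠ y)
    (U : Finset (Fin M → ℝ) → ℝ)
    (hU : ∀ A B : Finset (Fin M → ℝ), A.Nonempty → B.Nonempty →
      (∀ b ∈ B, ∃ a ∈ A, ∀ m, b m ≤ a m) → U B ≤ U A) :
    Ystar.Nonempty ∧ ∀ A ⊆ Y, A.Nonempty → U A ≤ U Ystar := by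
  have dominated : ∀ y ∈ Y, ∃ z ∈ Ystar, ∀ m, y m ≤ z m := by
    intro y hy
    obtain ⟨z, hyz, hz⟩ := Y.exists_le_maximal hy
    refine ⟨z, (hYstar z).2 ⟨hz.prop, ?_⟩, hyz⟩
    rintro ⟨y', hy', hle, hne⟩
    exact hne (hz.eq_of_le hy' hle).symm
  have nonempty : Ystar.Nonempty := by
    obtain ⟨y, hy⟩ := hY
    obtain ⟨z, hz, -⟩ := dominated y hy
    exact ⟨z, hz⟩
  exact ⟨nonempty, fun A hAY hA => hU Ystar A nonempty hA fun b hb => dominated b (hAY hb)⟩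
end

section
/- Let M ≥ 1, η ∈ ℝ^M, and let A, B be nonempty finite subsets of ℝ^M such that every point of A and of B strongly Pareto dominates η. Suppose the dominated region above η of A strictly contains that of B: every b ∈ B is weakly Pareto dominated by some a ∈ A, and there exists a ∈ A that is not weakly Pareto dominated by any b ∈ B. Then the hypervolume of A strictly exceeds that of B: the Lebesgue measure of ⋃_{a ∈ A} {z : η ≤ z ≤ a componentwise} is strictly greater than the Lebesgue measure of ⋃_{b ∈ B} {z : η ≤ z ≤ b componentwise}. -/
open MeasureTheory

/-- A box `[η, a]` with `η` strongly dominated by `a` meets the complement of any closed set that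
misses `a` in positive volume. -/
theorem volume_Icc_diff_pos_of_notMem {ι : Type*} [Fintype ι] {η a : ι → ℝ} {C : Set (ι → ℝ)}
    (hC : IsClosed C) (hη : ∀ i, η i < a i) (ha : a ∉ C) :
    0 < volume (Set.Icc η a \ C) := by
  have hmem : a ∈ closure (Set.univ.pi fun i => Set.Ioo (η i) (a i)) := by
    rw [closure_pi_set]
    intro i _
    beta_reduce
    rw [closure_Ioo (hη i).ne]
    exact Set.right_mem_Icc.2 (hη i).le
  have hopen : IsOpen (Cᶜ ∩ Set.univ.pi fun i => Set.Ioo (η i) (a i)) :=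
    hC.isOpen_compl.inter (isOpen_set_pi Set.finite_univ fun _ _ => isOpen_Ioo)
  refine (hopen.measure_pos volume (mem_closure_iff.1 hmem _ hC.isOpen_compl ha)).trans_le
    (measure_mono fun z hz => ⟨⟨fun i => ?_, fun i => ?_⟩, hz.1⟩)
  · exact (hz.2 i trivial).1.le
  · exact (hz.2 i trivial).2.le

/-- Strict Pareto compliancy of the hypervolume indicator: if all points of
the nonempty finite sets `A, B ⊆ ℝ^M` strongly dominate the reference point `η`, every
point of `B` is weakly dominated by some point of `A`, and some point of `A` is not weakly
dominated by any point of `B`, then the hypervolume of `A` strictly exceeds that of `B`. -/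
theorem hypervolume_strictly_pareto_compliant
    {M : ℕ} (hM : 1 ≤ M) (η : Fin M → ℝ)
    (A B : Finset (Fin M → ℝ)) (hA : A.Nonempty) (hB : B.Nonempty)
    (hAη : ∀ a ∈ A, ∀ m, η m < a m) (hBη : ∀ b ∈ B, ∀ m, η m < b m)
    (hdom : ∀ b ∈ B, ∃ a ∈ A, ∀ m, b m ≤ a m)
    (hstrict : ∃ a ∈ A, ∀ b ∈ B, ¬ (∀ m, a m ≤ b m)) :
    volume (⋃ b ∈ B, {z : Fin M → ℝ | ∀ m, η m ≤ z m ∧ z m ≤ b m}) <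
      volume (⋃ a ∈ A, {z : Fin M → ℝ | ∀ m, η m ≤ z m ∧ z m ≤ a m}) := by
  have hbox (b : Fin M → ℝ) : {z : Fin M → ℝ | ∀ m, η m ≤ z m ∧ z m ≤ b m} = Set.Icc η b := by
    ext z
    exact forall_and
  simp only [hbox]
  obtain ⟨a, haA, ha⟩ := hstrict
  have hcompact : IsCompact (⋃ b ∈ B, Set.Icc η b) := B.isCompact_biUnion fun _ _ => isCompact_Icc
  have hsub : (⋃ b ∈ B, Set.Icc η b) ⊆ ⋃ a ∈ A, Set.Icc η a := by
    refine Set.iUnion₂_subset fun b hb => ?_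
    obtain ⟨c, hc, hbc⟩ := hdom b hb
    exact (Set.Icc_subset_Icc_right hbc).trans (Set.subset_biUnion_of_mem (u := Set.Icc η) hc)
  have hnot : a ∉ ⋃ b ∈ B, Set.Icc η b := by
    simp only [Set.mem_iUnion, not_exists]
    exact fun b hb h => ha b hb h.2
  have hpos := volume_Icc_diff_pos_of_notMem hcompact.isClosed (hAη a haA) hnot
  rw [← tsub_pos_iff_lt, ← measure_sdiff hsub hcompact.measurableSet.nullMeasurableSet
    hcompact.measure_lt_top.ne]
  exact hpos.trans_le (measure_mono
    (Set.sdiff_subset_sdiff_left (Set.subset_biUnion_of_mem (u := Set.Icc η) haA)))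
end
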